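/- Let S be an inverse semigroup and N a normal inverse subsemigroup of S. If s ∈ S satisfies s ≤_N s², then s ∈ N. -/

import Mathlib

/-- An inverse semigroup: a semigroup in which every element `s` has a
(unique) inverse `s⁻¹` with `s * s⁻¹ * s = s` and `s⁻¹ * s * s⁻¹ = s⁻¹`. -/
class InverseSemigroup (S : Type*) extends Semigroup S, Inv S where
  mul_inv_mul : ∀ s : S, s * s⁻¹ * s = s
  inv_mul_inv : ∀ s : S, s⁻¹ * s * s⁻¹ = s⁻¹
  inv_unique : ∀ s t : S, s * t * s = s → t * s * t = t → t = s⁻¹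

/-- The natural partial order on an inverse semigroup:
`s ≤ t` iff `s = e * t` for some idempotent `e`. -/
def NatLe {S : Type*} [InverseSemigroup S] (s t : S) : Prop :=
  ∃ e : S, IsIdempotentElem e ∧ s = e * t

/-- A normal inverse subsemigroup: a full inverse subsemigroup that is
closed under conjugation. -/
structure IsNormalInverseSubsemigroup {S : Type*} [InverseSemigroup S] (N : Set S) : Prop where
  mul_mem : ∀ {a b : S}, a ∈ N → b ∈ N → a * b ∈ N
  inv_mem : ∀ {a : S}, a ∈ N → a⁻¹ ∈ N
  full : ∀ {e : S}, IsIdempotentElem e → e ∈ N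
  conj_mem : ∀ (s : S) {n : S}, n ∈ N → s⁻¹ * n * s ∈ N

/-- The preorder `≤_N` associated to a normal inverse subsemigroup `N`:
`s ≤_N t` iff there are `a, b ∈ N` with `a⁻¹ * a = s * s⁻¹`,
`s⁻¹ * s = b * b⁻¹` (so `a · s · b` is a trace product) and `a * s * b ≤ t`. -/
def LeN {S : Type*} [InverseSemigroup S] (N : Set S) (s t : S) : Prop :=
  ∃ a ∈ N, ∃ b ∈ N, a⁻¹ * a = s * s⁻¹ ∧ s⁻¹ * s = b * b⁻¹ ∧ NatLe (a * s * b) t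

/-- The equivalence `≃_N` obtained by symmetrizing `≤_N`. -/
def SimeqN {S : Type*} [InverseSemigroup S] (N : Set S) (s t : S) : Prop :=
  LeN N s t ∧ LeN N t s

namespace InverseSemigroup

variable {S : Type*} [InverseSemigroup S]

theorem inv_inv_self (s : S) : s⁻¹⁻¹ = s :=
  (inv_unique s⁻¹ s (inv_mul_inv s) (mul_inv_mul s)).symm

theorem isIdempotentElem_mul_inv (s : S) : IsIdempotentElem (s * s⁻¹) := by
  rw [IsIdempotentElem, ← mul_assoc, mul_inv_mul]

theorem inv_eq_self_of_isIdempotentElem {e : S} (he : IsIdempotentElem e) : e⁻¹ = e :=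
  (inv_unique e e (by rw [he.eq, he.eq]) (by rw [he.eq, he.eq])).symm

theorem isIdempotentElem_mul {e f : S} (he : IsIdempotentElem e) (hf : IsIdempotentElem f) :
    IsIdempotentElem (e * f) := by
  have he' (z : S) : e * (e * z) = e * z := by rw [← mul_assoc, he.eq]
  have hf' (z : S) : f * (f * z) = f * z := by rw [← mul_assoc, hf.eq]
  have h₁ := mul_inv_mul (e * f)
  have h₂ := inv_mul_inv (e * f)
  set x := (e * f)⁻¹ with hx
  have h₃ : f * x * e = x := by
    refine inv_unique (e * f) (f * x * e) ?_ ?_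
    · simpa only [mul_assoc, he', hf'] using h₁
    · have := congrArg (fun z => f * z * e) h₂
      simpa only [mul_assoc, he', hf'] using this
  have hxi : IsIdempotentElem x := by
    have := congrArg (fun z => f * z * e) h₂
    simp only [mul_assoc] at this
    rw [IsIdempotentElem]
    nth_rw 1 2 [← h₃]
    simp only [mul_assoc]
    rw [this, ← mul_assoc, h₃]
  have : e * f = x := by
    rw [← inv_inv_self (e * f), ← hx, inv_eq_self_of_isIdempotentElem hxi]
  rwa [this]

theorem mul_comm_of_isIdempotentElem {e f : S} (he : IsIdempotentElem e)
    (hf : IsIdempotentElem f) : e * f = f * e := by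
  have he' (z : S) : e * (e * z) = e * z := by rw [← mul_assoc, he.eq]
  have hf' (z : S) : f * (f * z) = f * z := by rw [← mul_assoc, hf.eq]
  have hef := isIdempotentElem_mul he hf
  have hfe := isIdempotentElem_mul hf he
  rw [← inv_eq_self_of_isIdempotentElem hef]
  refine (inv_unique (e * f) (f * e) ?_ ?_).symm
  · simpa only [IsIdempotentElem, mul_assoc, he', hf'] using hef
  · simpa only [IsIdempotentElem, mul_assoc, he', hf'] using hfe

theorem isIdempotentElem_conj {e : S} (he : IsIdempotentElem e) (s : S) :
    IsIdempotentElem (s⁻¹ * e * s) := by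
  calc s⁻¹ * e * s * (s⁻¹ * e * s) = s⁻¹ * (e * (s * s⁻¹)) * e * s := by simp only [mul_assoc]
    _ = s⁻¹ * s * s⁻¹ * (e * e) * s := by
      rw [mul_comm_of_isIdempotentElem he (isIdempotentElem_mul_inv s)]; simp only [mul_assoc]
    _ = s⁻¹ * e * s := by rw [inv_mul_inv, he.eq]

/-- If `x = f * y ≤ y`, then `x` is the restriction of `y` to the domain of `x`. -/
theorem mul_inv_mul_of_eq_idempotent_mul {f x y : S} (hf : IsIdempotentElem f)
    (hx : x = f * y) : y * (x⁻¹ * x) = x := by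
  have hc : y * y⁻¹ * f = f * (y * y⁻¹) :=
    mul_comm_of_isIdempotentElem (isIdempotentElem_mul_inv y) hf
  have hf' (z : S) : f * (f * z) = f * z := by rw [← mul_assoc, hf.eq]
  have h₁ : y * (y⁻¹ * f * x) = x := by
    calc y * (y⁻¹ * f * x) = y * y⁻¹ * f * x := by simp only [mul_assoc]
      _ = f * (y * y⁻¹ * y) := by rw [hc, hx, mul_assoc f, ← mul_assoc _ f, hc, mul_assoc f, hf']
      _ = x := by rw [mul_inv_mul, hx]
  have h₂ : y⁻¹ * f = x⁻¹ := by
    refine inv_unique x (y⁻¹ * f) ?_ ?_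
    · calc x * (y⁻¹ * f) * x = f * (y * (y⁻¹ * f * x)) := by
            nth_rw 1 [hx]; simp only [mul_assoc]
        _ = x := by rw [h₁, hx, hf']
    · calc y⁻¹ * f * x * (y⁻¹ * f) = y⁻¹ * (f * (y * y⁻¹)) * f := by
            rw [hx]; simp only [mul_assoc, hf']
        _ = y⁻¹ * y * y⁻¹ * (f * f) := by rw [← hc]; simp only [mul_assoc]
        _ = y⁻¹ * f := by rw [inv_mul_inv, hf.eq]
  rw [← h₂, h₁]

/-- If a trace product `a * s * b` lies below `s * s`, then `s` is a product of a conjugate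
of `b` and a conjugate of `a`. -/
theorem eq_conj_mul_conj_of_natLe_sq {a b s : S} (ha : a⁻¹ * a = s * s⁻¹)
    (hb : s⁻¹ * s = b * b⁻¹) (h : NatLe (a * s * b) (s * s)) :
    s = (s * b * s⁻¹) * (s⁻¹ * a * s) := by
  obtain ⟨e, he, h⟩ := h
  have has : a * s * s⁻¹ = a := by rw [mul_assoc, ← ha, ← mul_assoc, mul_inv_mul]
  have hsb : s⁻¹ * s * b = b := by rw [hb, mul_inv_mul]
  have hsbb : s * b * b⁻¹ = s := by rw [mul_assoc, ← hb, ← mul_assoc, mul_inv_mul]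
  have hbs : b⁻¹ * (s⁻¹ * s) = b⁻¹ := by rw [hb, ← mul_assoc, inv_mul_inv]
  have hasbb : a * s * b * b⁻¹ = a * s := by rw [mul_assoc a, mul_assoc a, hsbb]
  have hran : s * s⁻¹ * a = a := by
    have h₁ : s * s⁻¹ * (a * s * b) = a * s * b := by
      calc s * s⁻¹ * (a * s * b) = s * s⁻¹ * e * (s * s) := by rw [h]; simp only [mul_assoc]
        _ = e * (s * s⁻¹ * s) * s := by
          rw [mul_comm_of_isIdempotentElem (isIdempotentElem_mul_inv s) he]
          simp only [mul_assoc]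
        _ = a * s * b := by rw [mul_inv_mul, h]; simp only [mul_assoc]
    calc s * s⁻¹ * a = s * s⁻¹ * (a * s * b) * b⁻¹ * s⁻¹ := by
          rw [mul_assoc (s * s⁻¹), hasbb, mul_assoc (s * s⁻¹), has]
      _ = a := by rw [h₁, hasbb, has]
  have hdom : b * (s⁻¹ * s) = b := by
    have h₁ : a * s * b * (s⁻¹ * s) = a * s * b := by
      calc a * s * b * (s⁻¹ * s) = e * s * (s * s⁻¹ * s) := by rw [h]; simp only [mul_assoc]
        _ = a * s * b := by rw [mul_inv_mul, h]; simp only [mul_assoc]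
    have h₂ : s⁻¹ * a⁻¹ * (a * s * b) = b := by
      calc s⁻¹ * a⁻¹ * (a * s * b) = s⁻¹ * (a⁻¹ * a) * s * b := by simp only [mul_assoc]
        _ = s⁻¹ * s * s⁻¹ * s * b := by rw [ha]; simp only [mul_assoc]
        _ = b := by rw [inv_mul_inv, hsb]
    calc b * (s⁻¹ * s) = s⁻¹ * a⁻¹ * (a * s * b * (s⁻¹ * s)) := by
          rw [← mul_assoc (s⁻¹ * a⁻¹), h₂]
      _ = b := by rw [h₁, h₂]
  set x := s⁻¹ * a * s with hx
  have hxy : x = (s⁻¹ * e * s) * (s * b⁻¹) := by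
    calc x = s⁻¹ * (a * s * b * b⁻¹) := by rw [hasbb, hx, mul_assoc]
      _ = _ := by rw [h]; simp only [mul_assoc]
  have hzx : s⁻¹ * a⁻¹ * s * x = s⁻¹ * s := by
    calc s⁻¹ * a⁻¹ * s * x = s⁻¹ * a⁻¹ * (s * s⁻¹ * a) * s := by
          rw [hx]; simp only [mul_assoc]
      _ = s⁻¹ * (a⁻¹ * a) * s := by rw [hran]; simp only [mul_assoc]
      _ = s⁻¹ * s * s⁻¹ * s := by rw [ha]; simp only [mul_assoc]
      _ = s⁻¹ * s := by rw [inv_mul_inv]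
  have hinv : s⁻¹ * a⁻¹ * s = x⁻¹ := by
    refine inv_unique x _ ?_ ?_
    · calc x * (s⁻¹ * a⁻¹ * s) * x = s⁻¹ * a * (s * s⁻¹ * s) := by
            rw [mul_assoc, hzx, hx]; simp only [mul_assoc]
        _ = x := by rw [mul_inv_mul]
    · calc s⁻¹ * a⁻¹ * s * x * (s⁻¹ * a⁻¹ * s) = s⁻¹ * s * s⁻¹ * (a⁻¹ * s) := by
            rw [hzx]; simp only [mul_assoc]
        _ = s⁻¹ * a⁻¹ * s := by rw [inv_mul_inv, mul_assoc]
  have hxsb : x = s * b⁻¹ := by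
    have h₁ := mul_inv_mul_of_eq_idempotent_mul (isIdempotentElem_conj he s) hxy
    rw [← h₁, ← hinv, hzx, mul_assoc, hbs]
  calc s = s * b * b⁻¹ := hsbb.symm
    _ = s * (b * (s⁻¹ * s)) * b⁻¹ := by rw [hdom]
    _ = s * b * s⁻¹ * x := by rw [hxsb]; simp only [mul_assoc]

end InverseSemigroup

/-- If `s ≤_N s²` then `s ∈ N`. -/
theorem leN_sq_imp_mem {S : Type*} [InverseSemigroup S] {N : Set S}
    (hN : IsNormalInverseSubsemigroup N) {s : S} (h : LeN N s (s * s)) :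
    s ∈ N := by
  obtain ⟨a, ha, b, hb, haa, hbb, hle⟩ := h
  rw [InverseSemigroup.eq_conj_mul_conj_of_natLe_sq haa hbb hle]
  refine hN.mul_mem ?_ (hN.conj_mem s ha)
  simpa only [InverseSemigroup.inv_inv_self] using hN.conj_mem s⁻¹ hb
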